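/- (Theorem 3, necessary conditions: free final time, specified final point.) Let x* : ℝ → ℝ be continuously differentiable, tf* > t0, x*(t0) = x0 and x*(tf*) = xf, and let a* ∈ ℝ. Suppose (x*, tf*) minimizes the free-time functional at a*: for every T > t0 and every continuously differentiable y : ℝ → ℝ with y(t0) = x0 and y(T) = xf, ∫_{t0}^{T} g(y(t), y'(t), a*, t) dt ≥ ∫_{t0}^{tf*} g(x*(t), x*'(t), a*, t) dt. Then: (a) x* satisfies the Euler–Lagrange equation in integrated form on [t0, tf*], i.e. there exists c ∈ ℝ with (∂g/∂v)(x*(t), x*'(t), a*, t) = c + ∫_{t0}^{t} (∂g/∂x)(x*(s), x*'(s), a*, s) ds for all t ∈ [t0, tf*]; and (b) the free-final-time transversality condition holds: g(x*(tf*), x*'(tf*), a*, tf*) − (∂g/∂v)(x*(tf*), x*'(tf*), a*, tf*) · x*'(tf*) = 0. -/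

import Mathlib

open Set Filter Topology MeasureTheory

theorem aux_mi {u v : ℝ → ℝ} (hu : Continuous u) (hv : Continuous v) (a b : ℝ) :
    IntervalIntegrable (fun t => u t * v t) volume a b :=
  (hu.mul hv).intervalIntegrable a b

theorem aux_param (F F' : ℝ → ℝ → ℝ) (a b : ℝ) (hF : Continuous (Function.uncurry F))
    (hF' : Continuous (Function.uncurry F'))
    (h : ∀ l t, HasDerivAt (fun l => F l t) (F' l t) l) (l0 : ℝ) :
    HasDerivAt (fun l => ∫ t in a..b, F l t) (∫ t in a..b, F' l0 t) l0 := by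
  have hK : IsCompact (Metric.closedBall l0 1 ×ˢ uIcc a b) :=
    (isCompact_closedBall l0 1).prod isCompact_uIcc
  obtain ⟨C, hC⟩ := hK.exists_bound_of_continuousOn hF'.continuousOn
  have h1 : ∀ l, Continuous (F l) := fun l => hF.comp (by fun_prop : Continuous fun t => (l, t))
  have h2 : ∀ l, Continuous (F' l) := fun l => hF'.comp (by fun_prop : Continuous fun t => (l, t))
  refine (intervalIntegral.hasDerivAt_integral_of_dominated_loc_of_deriv_le (F := F) (F' := F')
    (bound := fun _ => C) (Metric.closedBall_mem_nhds l0 one_pos) ?_ ?_ ?_ ?_ ?_ ?_).2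
  · exact Eventually.of_forall fun l => (h1 l).aestronglyMeasurable
  · exact (h1 l0).intervalIntegrable _ _
  · exact (h2 l0).aestronglyMeasurable
  · exact Eventually.of_forall fun t ht l hl => hC (l, t) ⟨hl, uIoc_subset_uIcc ht⟩
  · exact intervalIntegrable_const
  · exact Eventually.of_forall fun t ht l hl => h l t

theorem aux_move (F : ℝ → ℝ → ℝ) (b : ℝ) (hF : Continuous (Function.uncurry F)) (l : ℝ → ℝ)
    (hl : ContinuousAt l b) :
    HasDerivAt (fun T => ∫ t in b..T, F (l T) t) (F (l b) b) b := by
  have h1 : ∀ l, Continuous (F l) := fun l => hF.comp (by fun_prop : Continuous fun t => (l, t))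
  rw [hasDerivAt_iff_isLittleO, Asymptotics.isLittleO_iff]
  intro c hc
  have h2 := Metric.continuousAt_iff.1 (hF.continuousAt (x := (l b, b))) c hc
  obtain ⟨d, hd, h2⟩ := h2
  obtain ⟨e, he, h3⟩ := Metric.continuousAt_iff.1 hl d hd
  filter_upwards [Metric.ball_mem_nhds b (lt_min hd he)] with T hT
  rw [Metric.mem_ball, lt_min_iff] at hT
  have h4 : (∫ t in b..T, F (l T) t) - (∫ t in b..b, F (l b) t) - (T - b) • F (l b) b
      = ∫ t in b..T, (F (l T) t - F (l b) b) := by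
    rw [intervalIntegral.integral_sub ((h1 _).intervalIntegrable _ _) intervalIntegrable_const]
    simp
  rw [h4, Real.norm_eq_abs (T - b)]
  apply intervalIntegral.norm_integral_le_of_norm_le_const
  intro t ht
  have h5 : dist t b < d := by
    refine lt_of_le_of_lt ?_ hT.1
    rw [Real.dist_eq, Real.dist_eq]
    have := abs_sub_left_of_mem_uIcc (uIoc_subset_uIcc ht)
    simpa using this
  have := h2 (x := (l T, t)) (by
    rw [Prod.dist_eq]; exact max_lt (h3 hT.2) h5)
  rw [Real.dist_eq] at this
  exact this.le

/-- Theorem 3, necessary conditions: free final time, specified final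
point: If `(x*, tf*)` minimizes the free-time functional at `a*` among all curves
joining `x0` to `xf` over variable time horizons, then (a) `x*` satisfies the
Euler–Lagrange equation in integrated form on `[t0, tf*]`, and (b) the transversality
condition `g − g_v · x*'` vanishes at `tf*`. -/
theorem necessary_conditions_free_final_time_fixed_point
    (t0 x0 xf : ℝ)
    (g : ℝ → ℝ → ℝ → ℝ → ℝ)
    (hg : ContDiff ℝ 1 (fun p : ℝ × ℝ × ℝ × ℝ => g p.1 p.2.1 p.2.2.1 p.2.2.2))
    (xs : ℝ → ℝ) (tfs : ℝ) (as : ℝ)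
    (hxs : ContDiff ℝ 1 xs) (htfs : t0 < tfs)
    (hxs0 : xs t0 = x0) (hxsf : xs tfs = xf)
    (hmin : ∀ T : ℝ, t0 < T → ∀ y : ℝ → ℝ, ContDiff ℝ 1 y →
      y t0 = x0 → y T = xf →
      (∫ t in t0..tfs, g (xs t) (deriv xs t) as t) ≤
        ∫ t in t0..T, g (y t) (deriv y t) as t) :
    (∃ c : ℝ, ∀ t ∈ Set.Icc t0 tfs,
      deriv (fun v => g (xs t) v as t) (deriv xs t) =
        c + ∫ s in t0..t, deriv (fun y => g y (deriv xs s) as s) (xs s)) ∧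
    g (xs tfs) (deriv xs tfs) as tfs -
      deriv (fun v => g (xs tfs) v as tfs) (deriv xs tfs) * deriv xs tfs = 0 := by
  have hxd : Continuous (deriv xs) := hxs.continuous_deriv le_rfl
  have hxc : Continuous xs := hxs.continuous
  set G : ℝ × ℝ × ℝ × ℝ → ℝ := fun p => g p.1 p.2.1 p.2.2.1 p.2.2.2 with hG
  have hGc : Continuous G := hg.continuous
  have hGd : ∀ p, HasFDerivAt G (fderiv ℝ G p) p := fun p =>
    (hg.differentiable one_ne_zero p).hasFDerivAt
  have hGf : Continuous (fderiv ℝ G) := hg.continuous_fderiv one_ne_zero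
  have hlin : ∀ (p : ℝ × ℝ × ℝ × ℝ) (u w : ℝ), fderiv ℝ G p (u, w, 0, 0) =
      fderiv ℝ G p (1, 0, 0, 0) * u + fderiv ℝ G p (0, 1, 0, 0) * w := by
    intro p u w
    have : ((u, w, 0, 0) : ℝ × ℝ × ℝ × ℝ) = u • (1, 0, 0, 0) + w • (0, 1, 0, 0) := by
      simp
    rw [this, map_add, map_smul, map_smul, smul_eq_mul, smul_eq_mul]; ring
  have hpath : ∀ (x v u w t l : ℝ), HasDerivAt (fun l => g (x + l * u) (v + l * w) as t)
      (fderiv ℝ G (x + l * u, v + l * w, as, t) (u, w, 0, 0)) l := by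
    intro x v u w t l
    have h1 : HasDerivAt (fun l : ℝ => ((x + l * u, v + l * w, as, t) : ℝ × ℝ × ℝ × ℝ))
        (u, w, 0, 0) l := by
      refine HasDerivAt.prodMk ?_ (HasDerivAt.prodMk ?_ (HasDerivAt.prodMk ?_ ?_))
      · simpa using ((hasDerivAt_id l).mul_const u).const_add x
      · simpa using ((hasDerivAt_id l).mul_const w).const_add v
      · exact hasDerivAt_const _ _
      · exact hasDerivAt_const _ _
    exact (hGd _).comp_hasDerivAt l h1
  set gx : ℝ → ℝ := fun s => deriv (fun y => g y (deriv xs s) as s) (xs s) with hgx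
  set gv : ℝ → ℝ := fun t => deriv (fun v => g (xs t) v as t) (deriv xs t) with hgv
  have hgx' : ∀ s, gx s = fderiv ℝ G (xs s, deriv xs s, as, s) (1, 0, 0, 0) := by
    intro s
    have h := hpath 0 (deriv xs s) 1 0 s (xs s)
    simp only [zero_add, mul_one, mul_zero, add_zero] at h
    exact h.deriv
  have hgv' : ∀ s, gv s = fderiv ℝ G (xs s, deriv xs s, as, s) (0, 1, 0, 0) := by
    intro s
    have h := hpath (xs s) 0 0 1 s (deriv xs s)
    simp only [zero_add, mul_one, mul_zero, add_zero] at h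
    exact h.deriv
  have hgxc : Continuous gx := by
    rw [funext hgx']
    exact (hGf.comp (by fun_prop : Continuous fun s => (xs s, deriv xs s, as, s))).clm_apply
      continuous_const
  have hgvc : Continuous gv := by
    rw [funext hgv']
    exact (hGf.comp (by fun_prop : Continuous fun s => (xs s, deriv xs s, as, s))).clm_apply
      continuous_const
  set P : ℝ → ℝ := fun t => ∫ s in t0..t, gx s with hP
  have hPd : ∀ t, HasDerivAt P (gx t) t := fun t =>
    intervalIntegral.integral_hasDerivAt_right (hgxc.intervalIntegrable _ _)
      hgxc.stronglyMeasurable.stronglyMeasurableAtFilter hgxc.continuousAt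
  have hPc : Continuous P := continuous_iff_continuousAt.2 fun t => (hPd t).continuousAt
  have hP0 : P t0 = 0 := intervalIntegral.integral_same
  have hLc : ∀ η η' : ℝ → ℝ, Continuous η → Continuous η' →
      Continuous (Function.uncurry fun l t => g (xs t + l * η t) (deriv xs t + l * η' t) as t) := by
    intro η η' h h'
    exact hGc.comp (by fun_prop : Continuous fun q : ℝ × ℝ =>
      (xs q.2 + q.1 * η q.2, deriv xs q.2 + q.1 * η' q.2, as, q.2))
  -- first variation
  have hvar : ∀ η η' : ℝ → ℝ, (∀ t, HasDerivAt η (η' t) t) → Continuous η' → η t0 = 0 →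
      HasDerivAt (fun l => ∫ t in t0..tfs, g (xs t + l * η t) (deriv xs t + l * η' t) as t)
        (P tfs * η tfs + ∫ t in t0..tfs, (gv t - P t) * η' t) 0 := by
    intro η η' hη hη' hη0
    have hηc : Continuous η := continuous_iff_continuousAt.2 fun t => (hη t).continuousAt
    have h := aux_param (fun l t => g (xs t + l * η t) (deriv xs t + l * η' t) as t)
      (fun l t => fderiv ℝ G (xs t + l * η t, deriv xs t + l * η' t, as, t) (η t, η' t, 0, 0))
      t0 tfs (hLc η η' hηc hη')
      ((hGf.comp (by fun_prop : Continuous fun q : ℝ × ℝ =>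
        (xs q.2 + q.1 * η q.2, deriv xs q.2 + q.1 * η' q.2, as, q.2))).clm_apply
        (by fun_prop : Continuous fun q : ℝ × ℝ => ((η q.2, η' q.2, 0, 0) : ℝ × ℝ × ℝ × ℝ)))
      (fun l t => hpath _ _ _ _ _ _) 0
    convert! h using 1
    have hp := intervalIntegral.integral_mul_deriv_eq_deriv_mul (a := t0) (b := tfs)
      (u := P) (v := η) (u' := gx) (v' := η') (fun t _ => hPd t) (fun t _ => hη t)
      (hgxc.intervalIntegrable _ _) (hη'.intervalIntegrable _ _)
    have e1 : ∀ t, fderiv ℝ G (xs t + 0 * η t, deriv xs t + 0 * η' t, as, t) (η t, η' t, 0, 0)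
        = gx t * η t + gv t * η' t := by
      intro t
      rw [hlin, hgx', hgv']; simp
    simp only [e1, sub_mul]
    rw [intervalIntegral.integral_sub (aux_mi hgvc hη' _ _)
      (aux_mi hPc hη' _ _), intervalIntegral.integral_add
      (aux_mi hgxc hηc _ _) (aux_mi hgvc hη' _ _), hp, hη0]
    ring
  have hyd : ∀ (η η' : ℝ → ℝ), (∀ t, HasDerivAt η (η' t) t) → Continuous η' → ∀ l,
      ContDiff ℝ 1 (fun t => xs t + l * η t) ∧
      ∀ t, deriv (fun t => xs t + l * η t) t = deriv xs t + l * η' t := by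
    intro η η' hη hη' l
    have h1 : ∀ t, HasDerivAt (fun t => xs t + l * η t) (deriv xs t + l * η' t) t := fun t =>
      ((hxs.differentiable one_ne_zero t).hasDerivAt).add ((hη t).const_mul l)
    have h2 : ∀ t, deriv (fun t => xs t + l * η t) t = deriv xs t + l * η' t :=
      fun t => (h1 t).deriv
    refine ⟨contDiff_one_iff_deriv.2 ⟨fun t => (h1 t).differentiableAt, ?_⟩, h2⟩
    rw [funext h2]; fun_prop
  -- du Bois-Reymond
  set h : ℝ → ℝ := fun t => gv t - P t with hh
  have hhc : Continuous h := hgvc.sub hPc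
  set c : ℝ := (∫ t in t0..tfs, h t) / (tfs - t0) with hcdef
  have hne : tfs - t0 ≠ 0 := (sub_pos.2 htfs).ne'
  have hc0 : ∫ t in t0..tfs, (h t - c) = 0 := by
    rw [intervalIntegral.integral_sub (hhc.intervalIntegrable _ _) intervalIntegrable_const]
    simp only [intervalIntegral.integral_const, smul_eq_mul, hcdef]
    field_simp; ring
  have hconst : ∀ t ∈ Icc t0 tfs, h t = c := by
    have hhcc : Continuous fun t => h t - c := hhc.sub continuous_const
    have hη : ∀ t, HasDerivAt (fun t => ∫ s in t0..t, (h s - c)) (h t - c) t := fun t =>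
      intervalIntegral.integral_hasDerivAt_right (hhcc.intervalIntegrable _ _)
        hhcc.stronglyMeasurable.stronglyMeasurableAtFilter hhcc.continuousAt
    have hv := hvar _ _ hη hhcc intervalIntegral.integral_same
    have hmn : IsLocalMin (fun l => ∫ t in t0..tfs,
        g (xs t + l * ∫ s in t0..t, (h s - c)) (deriv xs t + l * (h t - c)) as t) 0 := by
      refine Eventually.of_forall fun l => ?_
      obtain ⟨k1, k2⟩ := hyd _ _ hη hhcc l
      have := hmin tfs htfs _ k1 (by simp [hxs0]) (by simp only [hc0]; simp [hxsf])
      simp only [k2] at this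
      simpa using this
    have h0 := hmn.hasDerivAt_eq_zero hv
    simp only [hc0, mul_zero, zero_add] at h0
    by_contra! hcon
    obtain ⟨t, ht, hne'⟩ := hcon
    have hpos : 0 < ∫ t in t0..tfs, (h t - c) ^ 2 :=
      intervalIntegral.integral_pos htfs (hhcc.pow 2).continuousOn (fun _ _ => sq_nonneg _)
        ⟨t, ht, by have := sub_ne_zero.2 hne'; positivity⟩
    have e : ∫ t in t0..tfs, (h t - c) ^ 2 =
        (∫ t in t0..tfs, h t * (h t - c)) - c * ∫ t in t0..tfs, (h t - c) := by
      rw [← intervalIntegral.integral_const_mul, ← intervalIntegral.integral_sub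
        (aux_mi hhc hhcc _ _)
        (aux_mi (continuous_const (y := c)) hhcc _ _)]
      congr 1; ext t; ring
    rw [e, hc0] at hpos
    change (∫ t in t0..tfs, h t * (h t - c)) = 0 at h0
    rw [h0] at hpos
    simp at hpos
  refine ⟨⟨c, fun t ht => ?_⟩, ?_⟩
  · have := hconst t ht
    change gv t = c + P t
    simp only [hh] at this
    linarith
  · change g (xs tfs) (deriv xs tfs) as tfs - gv tfs * deriv xs tfs = 0
    have hη : ∀ t, HasDerivAt (fun t => t - t0) ((fun _ => (1 : ℝ)) t) t := fun t =>
      (hasDerivAt_id t).sub_const t0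
    have hv := hvar _ _ hη continuous_const (sub_self t0)
    have eD : P tfs * (tfs - t0) + ∫ t in t0..tfs, (gv t - P t) * 1 = gv tfs * (tfs - t0) := by
      have e1 : ∫ t in t0..tfs, (gv t - P t) * 1 = c * (tfs - t0) := by
        simp only [mul_one]
        change ∫ t in t0..tfs, h t = _
        rw [hcdef]; field_simp
      have e2 := hconst tfs ⟨htfs.le, le_rfl⟩
      simp only [hh] at e2
      rw [e1, ← e2]; ring
    rw [eD] at hv
    set l : ℝ → ℝ := fun T => (xf - xs T) / (T - t0) with hl
    have hl0 : l tfs = 0 := by simp [hl, hxsf]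
    have hld : HasDerivAt l (- deriv xs tfs / (tfs - t0)) tfs := by
      have h1 := (((hxs.differentiable one_ne_zero tfs).hasDerivAt).const_sub xf).div
        (hη tfs) hne
      convert! h1 using 1
      rw [hxsf]; field_simp; ring
    rw [← hl0] at hv
    have d1 := hv.comp tfs hld
    have d2 := aux_move (fun l t => g (xs t + l * (t - t0)) (deriv xs t + l * 1) as t) tfs
      (hLc _ _ (by fun_prop) continuous_const) l hld.continuousAt
    have d3 := d1.add d2
    have hmn : IsLocalMin (((fun l => ∫ t in t0..tfs,
        g (xs t + l * (t - t0)) (deriv xs t + l * 1) as t) ∘ l) + fun T => ∫ t in tfs..T,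
        g (xs t + l T * (t - t0)) (deriv xs t + l T * 1) as t) tfs := by
      filter_upwards [Ioi_mem_nhds htfs] with T hT
      have hT' : T - t0 ≠ 0 := (sub_pos.2 hT).ne'
      obtain ⟨k1, k2⟩ := hyd _ _ hη continuous_const (l T)
      have := hmin T hT _ k1 (by simp [hxs0]) (by simp only [hl]; field_simp; ring)
      simp only [k2] at this
      have hc1 : Continuous fun t => g (xs t + l T * (t - t0)) (deriv xs t + l T * 1) as t :=
        (hLc (fun t => t - t0) (fun _ => 1) (by fun_prop) continuous_const).comp
          (by fun_prop : Continuous fun t => (l T, t))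
      rw [← intervalIntegral.integral_add_adjacent_intervals (hc1.intervalIntegrable t0 tfs)
        (hc1.intervalIntegrable tfs T)] at this
      simpa [hl0] using this
    have h0 := hmn.hasDerivAt_eq_zero d3
    simp only [hl0, zero_mul, add_zero] at h0
    rw [← h0]; field_simp; ring
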